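/- arXiv:1402.4419 — 9 statements merged into one kernel-verified Lean document; each statement's English description precedes it below -/
import Mathlib

section
/- Let Θ ⊆ ℝ^p be a convex set, κ ∈ Θ, L > 0, f : ℝ^p → ℝ, let g be a first-order surrogate of f near κ in Θ (g ∈ S_L(f,κ)), and let θ' be a minimizer of g over Θ. Then f(θ') ≤ f(θ) + (L/2)‖θ − κ‖₂² for all θ ∈ Θ. -/
open MeasureTheory Filter Set
open scoped BigOperators NNReal Topology

noncomputable section

/-- `ℝ^p` with the Euclidean structure. -/
abbrev E (p : ℕ) := EuclideanSpace ℝ (Fin p)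

/-- A function `h` is `L`-smooth when it is differentiable and its gradient is
`L`-Lipschitz continuous. -/
def LSmooth {p : ℕ} (L : ℝ) (h : E p → ℝ) : Prop :=
  Differentiable ℝ h ∧ LipschitzWith L.toNNReal (gradient h)

/-- `g` is `ρ`-strongly convex: `θ ↦ g θ - (ρ/2)‖θ‖²` is convex. -/
def StrongConvex {p : ℕ} (ρ : ℝ) (g : E p → ℝ) : Prop :=
  ConvexOn ℝ Set.univ (fun θ => g θ - ρ / 2 * ‖θ‖ ^ 2)

/-- `g` is a first-order surrogate of `f` near `κ` in `Θ` (`g ∈ S_L(f,κ)`):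
(i) `g θ' ≥ f θ'` for every minimizer `θ'` of `g` over `Θ`; (ii) the
approximation error `h := g - f` is `L`-smooth, `h κ = 0` and `∇h κ = 0`. -/
def Surrogate {p : ℕ} (L : ℝ) (f g : E p → ℝ) (Θ : Set (E p)) (κ : E p) : Prop :=
  (∀ θ' ∈ Θ, IsMinOn g Θ θ' → f θ' ≤ g θ') ∧
  LSmooth L (fun θ => g θ - f θ) ∧
  g κ - f κ = 0 ∧ gradient (fun θ => g θ - f θ) κ = 0

/-- `g` is a majorizing first-order surrogate of `f` near `κ`:
`g ≥ f` everywhere and the error `h := g - f` is `L`-smooth, `h κ = 0`, `∇h κ = 0`. -/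
def MajSurrogate {p : ℕ} (L : ℝ) (f g : E p → ℝ) (κ : E p) : Prop :=
  (∀ θ, f θ ≤ g θ) ∧
  LSmooth L (fun θ => g θ - f θ) ∧
  g κ - f κ = 0 ∧ gradient (fun θ => g θ - f θ) κ = 0

/-- `l` is the directional derivative `∇f(θ, d) = lim_{t→0⁺} (f(θ + t d) - f θ)/t`. -/
def HasDirDeriv {p : ℕ} (f : E p → ℝ) (θ d : E p) (l : ℝ) : Prop :=
  Tendsto (fun t : ℝ => (f (θ + t • d) - f θ) / t) (𝓝[>] (0:ℝ)) (𝓝 l)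

/-- The asymptotic stationary point condition
`liminf_{n→∞} inf_{θ ∈ Θ, θ ≠ θₙ} ∇f(θₙ, θ - θₙ)/‖θ - θₙ‖ ≥ 0`, where `df θ d`
denotes the directional derivative `∇f(θ, d)`, unfolded in ε-N form. -/
def AsympStationary {p : ℕ} (Θ : Set (E p)) (df : E p → E p → ℝ) (θseq : ℕ → E p) : Prop :=
  ∀ ε > 0, ∃ N : ℕ, ∀ n ≥ N, ∀ θ ∈ Θ, θ ≠ θseq n →
    df (θseq n) (θ - θseq n) / ‖θ - θseq n‖ ≥ -ε

/-- The quadratic upper bound for an `L`-smooth function around a point `κ`. -/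
theorem LSmooth.le_add_inner_add_sq {p : ℕ} {L : ℝ} (hL : 0 ≤ L) {h : E p → ℝ}
    (hh : LSmooth L h) (κ θ : E p) :
    h θ ≤ h κ + inner ℝ (gradient h κ) (θ - κ) + L / 2 * ‖θ - κ‖ ^ 2 := by
  obtain ⟨hd, hlip⟩ := hh
  have hline (t : ℝ) : HasDerivAt (fun s : ℝ => κ + s • (θ - κ)) (θ - κ) t := by
    simpa using ((hasDerivAt_id t).smul_const (θ - κ)).const_add κ
  have hder (t : ℝ) : HasDerivAt (fun s : ℝ => h (κ + s • (θ - κ)))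
      (inner ℝ (gradient h (κ + t • (θ - κ))) (θ - κ)) t := by
    exact (hd _).hasGradientAt.hasFDerivAt.comp_hasDerivAt t (hline t)
  have hB (t : ℝ) : HasDerivAt
      (fun s : ℝ => h κ + s * inner ℝ (gradient h κ) (θ - κ) + L / 2 * ‖θ - κ‖ ^ 2 * s ^ 2)
      (inner ℝ (gradient h κ) (θ - κ) + L * t * ‖θ - κ‖ ^ 2) t := by
    refine ((((hasDerivAt_id t).mul_const (inner ℝ (gradient h κ) (θ - κ))).const_add
      (h κ)).add (((hasDerivAt_id t).pow 2).const_mul (L / 2 * ‖θ - κ‖ ^ 2))).congr_deriv ?_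
    norm_num
    ring
  have hbound (t : ℝ) (ht : t ∈ Ico (0 : ℝ) 1) :
      inner ℝ (gradient h (κ + t • (θ - κ))) (θ - κ) ≤
        inner ℝ (gradient h κ) (θ - κ) + L * t * ‖θ - κ‖ ^ 2 := by
    have hgrad : ‖gradient h (κ + t • (θ - κ)) - gradient h κ‖ ≤ L * (t * ‖θ - κ‖) := by
      have := hlip.norm_sub_le (κ + t • (θ - κ)) κ
      rwa [add_sub_cancel_left, norm_smul, Real.norm_of_nonneg ht.1,
        Real.coe_toNNReal L hL] at this
    have hinner := real_inner_le_norm (gradient h (κ + t • (θ - κ)) - gradient h κ) (θ - κ)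
    rw [inner_sub_left] at hinner
    nlinarith [mul_le_mul_of_nonneg_right hgrad (norm_nonneg (θ - κ))]
  have key := image_le_of_deriv_right_le_deriv_boundary
    (fun t _ => (hder t).continuousAt.continuousWithinAt)
    (fun t _ => (hder t).hasDerivWithinAt) (by simp)
    (fun t _ => (hB t).continuousAt.continuousWithinAt)
    (fun t _ => (hB t).hasDerivWithinAt) hbound (right_mem_Icc.2 zero_le_one)
  simpa using key

/-- Lemma 2.3 (second part): if `g ∈ S_L(f,κ)` and `θ'` minimizes `g` over `Θ`,
then `f θ' ≤ f θ + (L/2)‖θ - κ‖²` for all `θ ∈ Θ`. -/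
theorem surrogate_min_bound {p : ℕ} (Θ : Set (E p)) (hΘ : Convex ℝ Θ)
    (κ : E p) (hκ : κ ∈ Θ) (L : ℝ) (hL : 0 < L)
    (f g : E p → ℝ) (hg : Surrogate L f g Θ κ)
    (θ' : E p) (hθ' : θ' ∈ Θ) (hmin : IsMinOn g Θ θ') :
    ∀ θ ∈ Θ, f θ' ≤ f θ + L / 2 * ‖θ - κ‖ ^ 2 := by
  intro θ hθ
  obtain ⟨hmaj, hsmooth, hzero, hgrad⟩ := hg
  have hquad := hsmooth.le_add_inner_add_sq hL.le κ θ
  simp only [hgrad, hzero, inner_zero_left] at hquad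
  have hle : g θ' ≤ g θ := hmin hθ
  linarith [hmaj θ' hθ' hmin]
end
end

section
/- Let Θ ⊆ ℝ^p be a convex set, κ ∈ Θ, L > 0, ρ > 0, f : ℝ^p → ℝ, let g ∈ S_{L,ρ}(f,κ) be a ρ-strongly convex first-order surrogate of f near κ in Θ, and let θ' be a minimizer of g over Θ. Then for all θ ∈ Θ, f(θ') + (ρ/2)‖θ' − θ‖₂² ≤ f(θ) + (L/2)‖θ − κ‖₂². -/
open MeasureTheory Filter Set
open scoped BigOperators NNReal Topology

noncomputable section

/-- A strongly convex function grows quadratically away from a minimizer. -/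
lemma StrongConvexOn.add_sq_le_of_isMinOn {F : Type*} [NormedAddCommGroup F] [NormedSpace ℝ F]
    {s : Set F} {m : ℝ} {g : F → ℝ} (hg : StrongConvexOn s m g) {x y : F} (hx : x ∈ s)
    (hmin : IsMinOn g s x) (hy : y ∈ s) : g x + m / 2 * ‖x - y‖ ^ 2 ≤ g y := by
  have hlim : Tendsto (fun a : ℝ => g x + (1 - a) * (m / 2 * ‖x - y‖ ^ 2)) (𝓝[>] 0)
      (𝓝 (g x + m / 2 * ‖x - y‖ ^ 2)) := by
    refine Tendsto.mono_left ?_ nhdsWithin_le_nhds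
    exact Continuous.tendsto' (by fun_prop) _ _ (by ring)
  refine le_of_tendsto hlim ?_
  filter_upwards [Ioo_mem_nhdsGT (zero_lt_one' ℝ)] with a ⟨ha₀, ha₁⟩
  have hb : 0 ≤ 1 - a := by linarith
  have hab : a + (1 - a) = 1 := by ring
  have hconv := hg.2 hy hx ha₀.le hb hab
  have hle := isMinOn_iff.1 hmin _ (hg.1 hy hx ha₀.le hb hab)
  rw [norm_sub_rev y x] at hconv
  simp only [smul_eq_mul] at hconv
  refine le_of_mul_le_mul_left ?_ ha₀
  linarith

/-- The descent lemma: a function with `K`-Lipschitz gradient lies below its first-order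
expansion plus `K / 2` times the squared distance. -/
lemma LipschitzWith.le_add_inner_gradient_add_sq {F : Type*} [NormedAddCommGroup F]
    [InnerProductSpace ℝ F] [CompleteSpace F] {K : ℝ≥0} {h : F → ℝ} (hd : Differentiable ℝ h)
    (hK : LipschitzWith K (gradient h)) (x y : F) :
    h y ≤ h x + inner ℝ (gradient h x) (y - x) + K / 2 * ‖y - x‖ ^ 2 := by
  set v := y - x with hv
  have hline (t : ℝ) : HasDerivAt (fun t : ℝ => h (x + t • v))
      (inner ℝ (gradient h (x + t • v)) v) t := by
    have hγ : HasDerivAt (fun t : ℝ => x + t • v) v t := by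
      simpa using ((hasDerivAt_id t).smul_const v).const_add x
    rw [inner_gradient_left]
    exact (hd (x + t • v)).hasFDerivAt.comp_hasDerivAt t hγ
  have hquad (t : ℝ) : HasDerivAt
      (fun t : ℝ => h x + t * inner ℝ (gradient h x) v + K / 2 * ‖v‖ ^ 2 * t ^ 2)
      (inner ℝ (gradient h x) v + K * ‖v‖ ^ 2 * t) t := by
    refine ((((hasDerivAt_id t).mul_const (inner ℝ (gradient h x) v)).const_add (h x)).add
      ((hasDerivAt_pow 2 t).const_mul (K / 2 * ‖v‖ ^ 2))).congr_deriv ?_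
    push_cast
    ring
  have hbound (t : ℝ) (ht : t ∈ Ico (0 : ℝ) 1) :
      inner ℝ (gradient h (x + t • v)) v ≤ inner ℝ (gradient h x) v + K * ‖v‖ ^ 2 * t := by
    have hnorm : ‖gradient h (x + t • v) - gradient h x‖ ≤ K * (t * ‖v‖) := by
      simpa [norm_smul, abs_of_nonneg ht.1] using hK.norm_sub_le (x + t • v) x
    have hinner := (real_inner_le_norm (gradient h (x + t • v) - gradient h x) v).trans
      (mul_le_mul_of_nonneg_right hnorm (norm_nonneg v))
    rw [inner_sub_left] at hinner
    linarith
  have hone := image_le_of_deriv_right_le_deriv_boundary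
    (fun t _ => (hline t).continuousAt.continuousWithinAt)
    (fun t _ => (hline t).hasDerivWithinAt) (by simp)
    (fun t _ => (hquad t).continuousAt.continuousWithinAt)
    (fun t _ => (hquad t).hasDerivWithinAt) hbound (right_mem_Icc.2 zero_le_one)
  simpa [hv] using hone

/-- Lemma 2.3 (third part): if `g ∈ S_{L,ρ}(f,κ)` is a `ρ`-strongly convex
first-order surrogate and `θ'` minimizes `g` over `Θ`, then for all `θ ∈ Θ`,
`f θ' + (ρ/2)‖θ' - θ‖² ≤ f θ + (L/2)‖θ - κ‖²`. -/
theorem surrogate_strong_min_bound {p : ℕ} (Θ : Set (E p)) (hΘ : Convex ℝ Θ)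
    (κ : E p) (hκ : κ ∈ Θ) (L ρ : ℝ) (hL : 0 < L) (hρ : 0 < ρ)
    (f g : E p → ℝ) (hg : Surrogate L f g Θ κ) (hsc : StrongConvex ρ g)
    (θ' : E p) (hθ' : θ' ∈ Θ) (hmin : IsMinOn g Θ θ') :
    ∀ θ ∈ Θ, f θ' + ρ / 2 * ‖θ' - θ‖ ^ 2 ≤ f θ + L / 2 * ‖θ - κ‖ ^ 2 := by
  intro θ hθ
  obtain ⟨hmaj, ⟨hdiff, hlip⟩, hzero, hgrad⟩ := hg
  have hgrowth := (strongConvexOn_iff_convex.2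
    (hsc.subset (subset_univ Θ) hΘ)).add_sq_le_of_isMinOn hθ' hmin hθ
  have herr := hlip.le_add_inner_gradient_add_sq hdiff κ θ
  rw [hgrad, inner_zero_left, Real.coe_toNNReal L hL.le] at herr
  linarith [hmaj θ' hθ' hmin]
end
end

section
/- Let Θ ⊆ ℝ^p be a convex set and f : ℝ^p → ℝ be bounded below on Θ and such that the directional derivative ∇f(θ, θ'−θ) exists for all θ, θ' ∈ Θ. Let θ₀ ∈ Θ and for every n ≥ 1 let g_n be a majorizing first-order surrogate of f near θ_{n−1} in Θ (g_n ∈ S_L(f,θ_{n−1}) with g_n(θ) ≥ f(θ) for all θ), and let θ_n be a minimizer of g_n over Θ. Then the sequence (f(θ_n)) is non-increasing, and the sequence (θ_n) satisfies the asymptotic stationary point condition: liminf_{n→∞} inf_{θ ∈ Θ, θ ≠ θ_n} ∇f(θ_n, θ−θ_n)/‖θ−θ_n‖₂ ≥ 0. -/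
open MeasureTheory Filter Set
open scoped BigOperators NNReal Topology

noncomputable section

/-- A nonnegative function whose gradient is `L`-Lipschitz has its squared gradient norm
controlled by its value. -/
lemma norm_gradient_sq_le_of_nonneg {F : Type*} [NormedAddCommGroup F] [InnerProductSpace ℝ F]
    [CompleteSpace F] {L : ℝ≥0} (hL : 0 < L) {h : F → ℝ} (hd : Differentiable ℝ h)
    (hlip : LipschitzWith L (gradient h)) (hnn : ∀ x, 0 ≤ h x) (x : F) :
    ‖gradient h x‖ ^ 2 ≤ 4 * L * h x := by
  have hL' : (0 : ℝ) < L := hL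
  set v := gradient h x with hv
  set s : ℝ := (2 * (L : ℝ))⁻¹ with hs
  have hs0 : 0 < s := by positivity
  set y := x - s • v with hy
  have hyx : y - x = -(s • v) := by rw [hy]; abel
  have hnorm : ‖y - x‖ = s * ‖v‖ := by
    rw [hyx, norm_neg, norm_smul, Real.norm_of_nonneg hs0.le]
  have key := (convex_segment (𝕜 := ℝ) x y).norm_image_sub_le_of_norm_hasFDerivWithin_le'
    (f := h) (f' := fun z => InnerProductSpace.toDual ℝ F (gradient h z))
    (φ := InnerProductSpace.toDual ℝ F v) (C := L * (s * ‖v‖))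
    (fun z _ => (hd z).hasGradientAt.hasFDerivAt.hasFDerivWithinAt)
    (fun z hz => by
      rw [← map_sub, LinearIsometryEquiv.norm_map]
      refine (hlip.norm_sub_le z x).trans ?_
      rw [← hnorm]
      gcongr
      exact norm_sub_le_of_mem_segment hz)
    (left_mem_segment ℝ x y) (right_mem_segment ℝ x y)
  rw [hnorm, InnerProductSpace.toDual_apply_apply, hyx, inner_neg_right, real_inner_smul_right,
    real_inner_self_eq_norm_sq] at key
  have hle := (abs_le.mp key).2
  have hLs : (L : ℝ) * s = 1 / 2 := by rw [hs]; field_simp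
  have hquad : (L : ℝ) * (s * ‖v‖) * (s * ‖v‖) = s * ‖v‖ ^ 2 / 2 := by
    linear_combination (s * ‖v‖ ^ 2) * hLs
  have hsv : s * ‖v‖ ^ 2 ≤ 2 * h x := by
    have := hnn y
    linarith
  have hscale : ‖v‖ ^ 2 = 2 * L * (s * ‖v‖ ^ 2) := by
    linear_combination (-2 * ‖v‖ ^ 2) * hLs
  rw [hscale]
  nlinarith

/-- If `θ` minimizes `g` over a convex set, the directional derivatives of `f` at `θ` towards the
set are bounded below by minus the norm of the gradient of `g - f`. -/
lemma HasDirDeriv.neg_norm_gradient_mul_norm_le {p : ℕ} {Θ : Set (E p)} (hΘ : Convex ℝ Θ)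
    {f g : E p → ℝ} {θ θ' : E p} (hθ : θ ∈ Θ) (hθ' : θ' ∈ Θ) {l : ℝ}
    (hf : HasDirDeriv f θ (θ' - θ) l) (hmin : IsMinOn g Θ θ)
    (hd : DifferentiableAt ℝ (fun x => g x - f x) θ) :
    -(‖gradient (fun x => g x - f x) θ‖ * ‖θ' - θ‖) ≤ l := by
  set h : E p → ℝ := fun x => g x - f x with hh
  have hlim : Tendsto (fun t : ℝ => (h (θ + t • (θ' - θ)) - h θ) / t) (𝓝[>] (0 : ℝ))
      (𝓝 (inner ℝ (gradient h θ) (θ' - θ))) := by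
    have hline := hd.hasGradientAt.hasFDerivAt.hasLineDerivAt (θ' - θ)
    rw [InnerProductSpace.toDual_apply_apply] at hline
    refine hline.tendsto_slope_zero_right.congr fun t => ?_
    rw [smul_eq_mul, div_eq_inv_mul]
  have hge : -inner ℝ (gradient h θ) (θ' - θ) ≤ l := by
    refine le_of_tendsto_of_tendsto hlim.neg hf ?_
    filter_upwards [Ioc_mem_nhdsGT (zero_lt_one' ℝ)] with t ht
    have hg : g θ ≤ g (θ + t • (θ' - θ)) :=
      hmin (hΘ.add_smul_sub_mem hθ hθ' ⟨ht.1.le, ht.2⟩)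
    rw [← neg_div]
    refine div_le_div_of_nonneg_right ?_ ht.1.le
    simp only [hh]
    linarith
  exact (neg_le_neg (real_inner_le_norm _ _)).trans hge

/-- Proposition 2.5 (majorizing case): majorization-minimization with
majorizing first-order surrogates. The objective values are non-increasing and
the iterates satisfy the asymptotic stationary point condition. -/
theorem mm_nonconvex_majorizing {p : ℕ} (Θ : Set (E p)) (hΘ : Convex ℝ Θ)
    (L : ℝ) (hL : 0 < L) (f : E p → ℝ)
    (hbdd : ∃ B, ∀ θ ∈ Θ, B ≤ f θ)
    (df : E p → E p → ℝ)
    (hdf : ∀ θ ∈ Θ, ∀ θ' ∈ Θ, HasDirDeriv f θ (θ' - θ) (df θ (θ' - θ)))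
    (θseq : ℕ → E p) (g : ℕ → E p → ℝ)
    (hθ0 : θseq 0 ∈ Θ)
    (hsur : ∀ n : ℕ, Surrogate L f (g (n+1)) Θ (θseq n))
    (hmaj : ∀ n : ℕ, ∀ θ, f θ ≤ g (n+1) θ)
    (hmem : ∀ n : ℕ, θseq (n+1) ∈ Θ)
    (hmin : ∀ n : ℕ, IsMinOn (g (n+1)) Θ (θseq (n+1))) :
    Antitone (fun n => f (θseq n)) ∧ AsympStationary Θ df θseq := by
  have hstep (n : ℕ) : g (n + 1) (θseq (n + 1)) ≤ f (θseq n) := by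
    have hmem_n : θseq n ∈ Θ := by
      cases n with
      | zero => exact hθ0
      | succ k => exact hmem k
    have hle : g (n + 1) (θseq (n + 1)) ≤ g (n + 1) (θseq n) := hmin n hmem_n
    linarith [(hsur n).2.2.1]
  have hanti : Antitone (fun n => f (θseq n)) :=
    antitone_nat_of_succ_le fun n => (hmaj n _).trans (hstep n)
  refine ⟨hanti, fun ε hε => ?_⟩
  obtain ⟨B, hB⟩ := hbdd
  have hbelow : BddBelow (range fun n => f (θseq n)) := by
    refine ⟨B, ?_⟩
    rintro _ ⟨n, rfl⟩
    cases n with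
    | zero => exact hB _ hθ0
    | succ k => exact hB _ (hmem k)
  have hconv := tendsto_atTop_ciInf hanti hbelow
  have hdiff : Tendsto (fun n => 4 * L * (f (θseq n) - f (θseq (n + 1)))) atTop (𝓝 0) := by
    simpa using (hconv.sub (hconv.comp (tendsto_add_atTop_nat 1))).const_mul (4 * L)
  obtain ⟨N, hN⟩ := eventually_atTop.mp (hdiff.eventually_lt_const (sq_pos_of_pos hε))
  refine ⟨N + 1, fun n hn θ hθ hne => ?_⟩
  obtain ⟨m, rfl⟩ : ∃ m, n = m + 1 := ⟨n - 1, by omega⟩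
  obtain ⟨-, ⟨hd, hlip⟩, -, -⟩ := hsur m
  have hsq := norm_gradient_sq_le_of_nonneg (Real.toNNReal_pos.mpr hL) hd hlip
    (fun x => sub_nonneg.mpr (hmaj m x)) (θseq (m + 1))
  rw [Real.coe_toNNReal L hL.le] at hsq
  have hval : 4 * L * (g (m + 1) (θseq (m + 1)) - f (θseq (m + 1))) ≤
      4 * L * (f (θseq m) - f (θseq (m + 1))) := by
    gcongr
    exact hstep m
  have hgrad : ‖gradient (fun x => g (m + 1) x - f x) (θseq (m + 1))‖ ≤ ε :=
    le_of_sq_le_sq ((hsq.trans hval).trans (hN m (by omega)).le) hε.le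
  have hdir := (hdf _ (hmem m) θ hθ).neg_norm_gradient_mul_norm_le hΘ (hmem m) hθ (hmin m)
    (hd _)
  have hpos : 0 < ‖θ - θseq (m + 1)‖ := norm_sub_pos_iff.mpr hne
  rw [ge_iff_le, le_div_iff₀ hpos, neg_mul]
  exact (neg_le_neg (mul_le_mul_of_nonneg_right hgrad hpos.le)).trans hdir
end
end

section
/- Let Θ ⊆ ℝ^p be a convex set and f : ℝ^p → ℝ be bounded below on Θ and such that the directional derivative ∇f(θ, θ'−θ) exists for all θ, θ' ∈ Θ. Let θ₀ ∈ Θ, let ρ > 0, and for every n ≥ 1 let g_n ∈ S_{L,ρ}(f,θ_{n−1}) be a ρ-strongly convex first-order surrogate of f near θ_{n−1} in Θ, and let θ_n be a minimizer of g_n over Θ. Then the sequence (f(θ_n)) is non-increasing, and the sequence (θ_n) satisfies the asymptotic stationary point condition: liminf_{n→∞} inf_{θ ∈ Θ, θ ≠ θ_n} ∇f(θ_n, θ−θ_n)/‖θ−θ_n‖₂ ≥ 0. -/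
open MeasureTheory Filter Set
open scoped BigOperators NNReal Topology

noncomputable section

/-- A minimizer of a strongly convex function over a convex set satisfies a quadratic growth
inequality. -/
lemma StrongConvex.quadratic_growth {p : ℕ} {ρ : ℝ} {g : E p → ℝ} (hg : StrongConvex ρ g)
    {Θ : Set (E p)} (hΘ : Convex ℝ Θ) {x y : E p} (hx : x ∈ Θ) (hy : y ∈ Θ)
    (hmin : IsMinOn g Θ y) : g y + ρ / 4 * ‖x - y‖ ^ 2 ≤ g x := by
  have h := (strongConvexOn_iff_convex.2 hg).2 (mem_univ x) (mem_univ y)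
    (by norm_num : (0 : ℝ) ≤ 1 / 2) (by norm_num : (0 : ℝ) ≤ 1 / 2) (by norm_num)
  have hmid := isMinOn_iff.1 hmin _ (hΘ hx hy (by norm_num : (0 : ℝ) ≤ 1 / 2)
    (by norm_num : (0 : ℝ) ≤ 1 / 2) (by norm_num))
  simp only [smul_eq_mul] at h
  linarith

/-- A differentiable function has directional derivatives given by the gradient. -/
lemma hasDirDeriv_gradient {p : ℕ} {h : E p → ℝ} {x : E p} (hh : DifferentiableAt ℝ h x)
    (d : E p) : HasDirDeriv h x d (inner ℝ (gradient h x) d) := by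
  have hd := (hh.hasGradientAt.hasFDerivAt.hasLineDerivAt d).hasDerivWithinAt (s := Ioi 0)
  have := hasDerivWithinAt_iff_tendsto_slope.1 hd
  simpa [HasDirDeriv, slope_fun_def, div_eq_inv_mul] using this

/-- The values of `f` decrease at least quadratically in the step length. -/
lemma Surrogate.sufficient_decrease {p : ℕ} {L ρ : ℝ} {f g : E p → ℝ} {Θ : Set (E p)}
    {x y : E p} (hs : Surrogate L f g Θ x) (hg : StrongConvex ρ g) (hΘ : Convex ℝ Θ)
    (hx : x ∈ Θ) (hy : y ∈ Θ) (hmin : IsMinOn g Θ y) :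
    f y + ρ / 4 * ‖x - y‖ ^ 2 ≤ f x := by
  linarith [hs.1 y hy hmin, hs.2.2.1, hg.quadratic_growth hΘ hx hy hmin]

/-- At a minimizer of the surrogate, directional derivatives of `f` are bounded below in terms
of the step length. -/
lemma Surrogate.dirDeriv_lower_bound {p : ℕ} {L : ℝ} {f g : E p → ℝ} {Θ : Set (E p)}
    {x y z : E p} {l : ℝ} (hs : Surrogate L f g Θ x) (hL : 0 ≤ L) (hΘ : Convex ℝ Θ)
    (hy : y ∈ Θ) (hz : z ∈ Θ) (hmin : IsMinOn g Θ y) (hl : HasDirDeriv f y (z - y) l) :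
    -(L * ‖x - y‖) * ‖z - y‖ ≤ l := by
  obtain ⟨-, ⟨hdiff, hlip⟩, -, hgrad⟩ := hs
  set h : E p → ℝ := fun θ => g θ - f θ with hh
  have hsum := hl.add (hasDirDeriv_gradient (hdiff y) (z - y))
  have hnonneg : 0 ≤ l + inner ℝ (gradient h y) (z - y) := by
    refine ge_of_tendsto hsum ?_
    filter_upwards [Ioo_mem_nhdsGT (zero_lt_one' ℝ)] with t ht
    have hle : g y ≤ g (y + t • (z - y)) :=
      isMinOn_iff.1 hmin _ (hΘ.add_smul_sub_mem hy hz ⟨ht.1.le, ht.2.le⟩)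
    rw [← add_div]
    refine div_nonneg ?_ ht.1.le
    simp only [hh]
    linarith
  have hnorm : ‖gradient h y‖ ≤ L * ‖x - y‖ := by
    have := hlip.dist_le_mul y x
    rwa [hgrad, dist_zero_right, Real.coe_toNNReal _ hL, dist_eq_norm, norm_sub_rev] at this
  have hcs := real_inner_le_norm (gradient h y) (z - y)
  have := mul_le_mul_of_nonneg_right hnorm (norm_nonneg (z - y))
  linarith

/-- Proposition 2.5 (strongly convex case): majorization-minimization with
`ρ`-strongly convex first-order surrogates `gₙ ∈ S_{L,ρ}(f, θ_{n-1})`. The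
objective values are non-increasing and the iterates satisfy the asymptotic
stationary point condition. -/
theorem mm_nonconvex_strongly_convex {p : ℕ} (Θ : Set (E p)) (hΘ : Convex ℝ Θ)
    (L ρ : ℝ) (hL : 0 < L) (hρ : 0 < ρ) (f : E p → ℝ)
    (hbdd : ∃ B, ∀ θ ∈ Θ, B ≤ f θ)
    (df : E p → E p → ℝ)
    (hdf : ∀ θ ∈ Θ, ∀ θ' ∈ Θ, HasDirDeriv f θ (θ' - θ) (df θ (θ' - θ)))
    (θseq : ℕ → E p) (g : ℕ → E p → ℝ)
    (hθ0 : θseq 0 ∈ Θ)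
    (hsur : ∀ n : ℕ, Surrogate L f (g (n+1)) Θ (θseq n))
    (hsc : ∀ n : ℕ, StrongConvex ρ (g (n+1)))
    (hmem : ∀ n : ℕ, θseq (n+1) ∈ Θ)
    (hmin : ∀ n : ℕ, IsMinOn (g (n+1)) Θ (θseq (n+1))) :
    Antitone (fun n => f (θseq n)) ∧ AsympStationary Θ df θseq := by
  have hΘmem : ∀ n, θseq n ∈ Θ := fun n => n.casesOn hθ0 hmem
  have hdec : ∀ n, f (θseq (n + 1)) + ρ / 4 * ‖θseq n - θseq (n + 1)‖ ^ 2 ≤ f (θseq n) := fun n =>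
    (hsur n).sufficient_decrease (hsc n) hΘ (hΘmem n) (hmem n) (hmin n)
  have hanti : Antitone (fun n => f (θseq n)) := antitone_nat_of_succ_le fun n => by
    have : 0 ≤ ρ / 4 * ‖θseq n - θseq (n + 1)‖ ^ 2 := by positivity
    linarith [hdec n]
  refine ⟨hanti, fun ε hε => ?_⟩
  obtain ⟨B, hB⟩ := hbdd
  have hlim := tendsto_atTop_ciInf hanti ⟨B, by rintro _ ⟨n, rfl⟩; exact hB _ (hΘmem n)⟩
  have hgap := hlim.sub (hlim.comp (tendsto_add_atTop_nat 1))
  rw [sub_self] at hgap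
  obtain ⟨N, hN⟩ := eventually_atTop.1
    (hgap.eventually (gt_mem_nhds (show 0 < ρ / 4 * (ε / L) ^ 2 by positivity)))
  refine ⟨N + 1, fun n hn θ hθ hne => ?_⟩
  obtain ⟨m, rfl⟩ : ∃ m, n = m + 1 := ⟨n - 1, by omega⟩
  have hstep : ‖θseq m - θseq (m + 1)‖ < ε / L := by
    have h₁ := hN m (by omega)
    simp only [Function.comp_apply] at h₁
    have h₂ : ρ / 4 * ‖θseq m - θseq (m + 1)‖ ^ 2 < ρ / 4 * (ε / L) ^ 2 := by
      linarith [hdec m]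
    exact lt_of_pow_lt_pow_left₀ 2 (by positivity) (lt_of_mul_lt_mul_left h₂ (by positivity))
  have hbound := (hsur m).dirDeriv_lower_bound hL.le hΘ (hmem m) hθ (hmin m)
    (hdf _ (hmem m) θ hθ)
  have hpos : 0 < ‖θ - θseq (m + 1)‖ := norm_pos_iff.2 (sub_ne_zero.2 hne)
  rw [lt_div_iff₀' hL] at hstep
  rw [ge_iff_le, le_div_iff₀ hpos]
  exact (mul_le_mul_of_nonneg_right (neg_le_neg hstep.le) hpos.le).trans hbound
end
end

section
/- Let Θ ⊆ ℝ^p be a convex set, f : ℝ^p → ℝ be convex and bounded below on Θ, and θ* be a minimizer of f over Θ with f* := f(θ*). Assume there exists R > 0 such that ‖θ − θ*‖₂ ≤ R for all θ ∈ Θ with f(θ) ≤ f(θ₀). Let θ₀ ∈ Θ and for every n ≥ 1 let g_n ∈ S_L(f, θ_{n−1}) be a first-order surrogate of f near θ_{n−1} in Θ, and let θ_n be a minimizer of g_n over Θ. Then for all n ≥ 1, f(θ_n) − f* ≤ 2LR²/(n+2). -/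
open MeasureTheory Filter Set
open scoped BigOperators NNReal Topology

noncomputable section

/-- The quadratic upper bound for a function with Lipschitz gradient, at a point where both the
function and its gradient vanish. -/
theorem LSmooth.le_half_mul_norm_sub_sq {p : ℕ} {L : ℝ} (hL : 0 ≤ L) {h : E p → ℝ}
    (hs : LSmooth L h) {κ : E p} (h0 : h κ = 0) (hg0 : gradient h κ = 0) (x : E p) :
    h x ≤ L / 2 * ‖x - κ‖ ^ 2 := by
  obtain ⟨hd, hlip⟩ := hs
  set v := x - κ with hv
  have hline (t : ℝ) : HasDerivAt (fun t : ℝ => κ + t • v) v t := by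
    simpa using ((hasDerivAt_id t).smul_const v).const_add κ
  have hder (t : ℝ) : HasDerivAt (fun t : ℝ => h (κ + t • v) - L / 2 * t ^ 2 * ‖v‖ ^ 2)
      (inner ℝ (gradient h (κ + t • v)) v - L * t * ‖v‖ ^ 2) t := by
    have h1 := (hd (κ + t • v)).hasGradientAt.hasFDerivAt.comp_hasDerivAt t (hline t)
    have h2 := (((hasDerivAt_id t).pow 2).const_mul (L / 2)).mul_const (‖v‖ ^ 2)
    refine (h1.sub h2).congr_deriv ?_
    simp only [InnerProductSpace.toDual_apply_apply, id]
    ring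
  have hanti := antitoneOn_of_deriv_nonpos (convex_Icc (0 : ℝ) 1)
    (fun t _ => (hder t).continuousAt.continuousWithinAt)
    (fun t _ => (hder t).differentiableAt.differentiableWithinAt)
    (fun t ht => by
      rw [interior_Icc] at ht
      rw [(hder t).deriv, sub_nonpos]
      have hn := hlip.dist_le_mul (κ + t • v) κ
      rw [dist_eq_norm, dist_eq_norm, hg0, sub_zero, add_sub_cancel_left, norm_smul,
        Real.norm_of_nonneg ht.1.le, Real.coe_toNNReal L hL] at hn
      calc inner ℝ (gradient h (κ + t • v)) v ≤ ‖gradient h (κ + t • v)‖ * ‖v‖ :=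
            real_inner_le_norm _ _
        _ ≤ L * (t * ‖v‖) * ‖v‖ := by gcongr
        _ = L * t * ‖v‖ ^ 2 := by ring)
  have := hanti (left_mem_Icc.2 zero_le_one) (right_mem_Icc.2 zero_le_one) zero_le_one
  simpa [hv, h0] using this

/-- A minimizer of a first-order surrogate near `κ` improves on `f` up to a quadratic term. -/
theorem Surrogate.le_add_half_mul_norm_sub_sq {p : ℕ} {L : ℝ} (hL : 0 ≤ L) {f g : E p → ℝ}
    {Θ : Set (E p)} {κ θ' : E p} (hs : Surrogate L f g Θ κ) (hmem : θ' ∈ Θ)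
    (hmin : IsMinOn g Θ θ') {θ : E p} (hθ : θ ∈ Θ) :
    f θ' ≤ f θ + L / 2 * ‖θ - κ‖ ^ 2 := by
  obtain ⟨hmaj, hsm, h0, hg0⟩ := hs
  have h1 := hmaj θ' hmem hmin
  have h2 : g θ' ≤ g θ := hmin hθ
  have h3 := hsm.le_half_mul_norm_sub_sq hL h0 hg0 θ
  linarith

/-- Proposition 2.7 (non-strongly convex case): for convex `f` with bounded
level sets, majorization-minimization with surrogates `gₙ ∈ S_L(f, θ_{n-1})`
satisfies `f(θₙ) - f* ≤ 2LR²/(n+2)` for all `n ≥ 1`. -/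
theorem mm_convex_rate {p : ℕ} (Θ : Set (E p)) (hΘ : Convex ℝ Θ)
    (L : ℝ) (hL : 0 < L) (f : E p → ℝ)
    (hconv : ConvexOn ℝ Set.univ f)
    (hbdd : ∃ B, ∀ θ ∈ Θ, B ≤ f θ)
    (θstar : E p) (hθstar : θstar ∈ Θ) (hminf : IsMinOn f Θ θstar)
    (R : ℝ) (hR : 0 < R)
    (θseq : ℕ → E p) (g : ℕ → E p → ℝ)
    (hθ0 : θseq 0 ∈ Θ)
    (hlevel : ∀ θ ∈ Θ, f θ ≤ f (θseq 0) → ‖θ - θstar‖ ≤ R)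
    (hsur : ∀ n : ℕ, Surrogate L f (g (n+1)) Θ (θseq n))
    (hmem : ∀ n : ℕ, θseq (n+1) ∈ Θ)
    (hmin : ∀ n : ℕ, IsMinOn (g (n+1)) Θ (θseq (n+1))) :
    ∀ n : ℕ, 1 ≤ n → f (θseq n) - f θstar ≤ 2 * L * R ^ 2 / ((n : ℝ) + 2) := by
  have hseq (n : ℕ) : θseq n ∈ Θ := by
    cases n with
    | zero => exact hθ0
    | succ n => exact hmem n
  have hstep (n : ℕ) {θ : E p} (hθ : θ ∈ Θ) :
      f (θseq (n + 1)) ≤ f θ + L / 2 * ‖θ - θseq n‖ ^ 2 :=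
    (hsur n).le_add_half_mul_norm_sub_sq hL.le (hmem n) (hmin n) hθ
  have hanti : Antitone (fun n => f (θseq n)) :=
    antitone_nat_of_succ_le fun n => by simpa using hstep n (hseq n)
  have hdist (n : ℕ) : ‖θseq n - θstar‖ ≤ R := hlevel _ (hseq n) (hanti n.zero_le)
  have hrec (n : ℕ) {a : ℝ} (ha0 : 0 ≤ a) (ha1 : a ≤ 1) :
      f (θseq (n + 1)) - f θstar ≤
        (1 - a) * (f (θseq n) - f θstar) + L / 2 * (a * R) ^ 2 := by
    have h1 := hstep n (hΘ (hseq n) hθstar (sub_nonneg.2 ha1) ha0 (by ring))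
    have h2 := hconv.2 (mem_univ (θseq n)) (mem_univ θstar) (sub_nonneg.2 ha1) ha0 (by ring)
    have h3 : ‖(1 - a) • θseq n + a • θstar - θseq n‖ ≤ a * R := by
      have : (1 - a) • θseq n + a • θstar - θseq n = a • (θstar - θseq n) := by module
      rw [this, norm_smul, Real.norm_of_nonneg ha0, norm_sub_rev]
      exact mul_le_mul_of_nonneg_left (hdist n) ha0
    have h4 : L / 2 * ‖(1 - a) • θseq n + a • θstar - θseq n‖ ^ 2 ≤ L / 2 * (a * R) ^ 2 := by
      gcongr
    simp only [smul_eq_mul] at h2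
    linarith
  have hfrac (n : ℕ) : 2 * L * R ^ 2 * ((n + 1) / (n + 2) ^ 2) ≤
      2 * L * R ^ 2 / (((n + 1 : ℕ) : ℝ) + 2) := by
    rw [div_eq_mul_inv (2 * L * R ^ 2)]
    refine mul_le_mul_of_nonneg_left ?_ (by positivity)
    rw [← one_div, div_le_div_iff₀ (by positivity) (by positivity)]
    push_cast
    nlinarith
  intro n hn
  induction n, hn using Nat.le_induction with
  | base =>
    have h1 := hrec 0 zero_le_one le_rfl
    have h2 : 0 ≤ L * R ^ 2 := by positivity
    norm_num at h1 ⊢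
    linarith
  | succ n hn ih =>
    have hn' : (0 : ℝ) < n + 2 := by positivity
    have ha : 2 / ((n : ℝ) + 2) ≤ 1 := by
      rw [div_le_one hn']
      linarith [n.cast_nonneg (α := ℝ)]
    calc f (θseq (n + 1)) - f θstar
        ≤ (1 - 2 / ((n : ℝ) + 2)) * (f (θseq n) - f θstar)
            + L / 2 * (2 / ((n : ℝ) + 2) * R) ^ 2 := hrec n (by positivity) ha
      _ ≤ (1 - 2 / ((n : ℝ) + 2)) * (2 * L * R ^ 2 / ((n : ℝ) + 2))
            + L / 2 * (2 / ((n : ℝ) + 2) * R) ^ 2 := by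
          gcongr
      _ = 2 * L * R ^ 2 * ((n + 1) / (n + 2) ^ 2) := by
          field_simp
          ring
      _ ≤ _ := hfrac n
end
end

section
/- Let Θ ⊆ ℝ^p be a convex set, f : ℝ^p → ℝ be convex and bounded below on Θ, and θ* be a minimizer of f over Θ with f* := f(θ*). Let θ₀ ∈ Θ, let ρ ≥ L > 0, and for every n ≥ 1 let g_n ∈ S_{L,ρ}(f, θ_{n−1}) be a ρ-strongly convex first-order surrogate of f near θ_{n−1} in Θ, and let θ_n be a minimizer of g_n over Θ. Then for all n ≥ 1, f(θ_n) − f* ≤ L‖θ₀ − θ*‖₂²/(2n). -/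
open MeasureTheory Filter Set
open scoped BigOperators NNReal Topology

noncomputable section

/-- A function with `L`-Lipschitz gradient that vanishes to first order at `κ` is bounded above by
`θ ↦ L / 2 * ‖θ - κ‖ ^ 2`. -/
theorem LSmooth.le_of_gradient_eq_zero {p : ℕ} {L : ℝ} (hL : 0 ≤ L) {h : E p → ℝ}
    (hh : LSmooth L h) {κ : E p} (h0 : h κ = 0) (hg : gradient h κ = 0) (θ : E p) :
    h θ ≤ L / 2 * ‖θ - κ‖ ^ 2 := by
  set d := θ - κ with hd
  have hder (t : ℝ) : HasDerivAt (fun t : ℝ => h (κ + t • d) - L / 2 * ‖d‖ ^ 2 * t ^ 2)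
      (inner ℝ (gradient h (κ + t • d)) d - L / 2 * ‖d‖ ^ 2 * (2 * t)) t := by
    have hline : HasDerivAt (fun t : ℝ => κ + t • d) d t := by
      simpa using ((hasDerivAt_id t).smul_const d).const_add κ
    have hcomp := (hh.1 (κ + t • d)).hasGradientAt.hasFDerivAt.comp_hasDerivAt t hline
    have hsq : HasDerivAt (fun t : ℝ => L / 2 * ‖d‖ ^ 2 * t ^ 2) (L / 2 * ‖d‖ ^ 2 * (2 * t)) t := by
      simpa using (hasDerivAt_pow 2 t).const_mul (L / 2 * ‖d‖ ^ 2)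
    exact hcomp.sub hsq
  have hanti : AntitoneOn (fun t : ℝ => h (κ + t • d) - L / 2 * ‖d‖ ^ 2 * t ^ 2) (Icc 0 1) := by
    refine antitoneOn_of_hasDerivWithinAt_nonpos (convex_Icc 0 1)
      (fun t _ => (hder t).continuousAt.continuousWithinAt)
      (fun t _ => (hder t).hasDerivWithinAt) fun t ht => ?_
    rw [interior_Icc] at ht
    have hlip : ‖gradient h (κ + t • d)‖ ≤ L * (t * ‖d‖) := by
      simpa [hg, dist_eq_norm, norm_smul, hL, abs_of_pos ht.1]
        using hh.2.dist_le_mul (κ + t • d) κ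
    nlinarith [real_inner_le_norm (gradient h (κ + t • d)) d,
      mul_le_mul_of_nonneg_right hlip (norm_nonneg d)]
  have h01 := hanti (left_mem_Icc.2 zero_le_one) (right_mem_Icc.2 zero_le_one) zero_le_one
  simp [hd, h0] at h01
  linarith

/-- Quadratic growth of a strongly convex function away from a minimizer over a convex set. -/
theorem StrongConvex.add_sq_le_of_isMinOn {p : ℕ} {ρ : ℝ} {g : E p → ℝ} (hg : StrongConvex ρ g)
    {Θ : Set (E p)} (hΘ : Convex ℝ Θ) {m θ : E p} (hm : m ∈ Θ) (hmin : IsMinOn g Θ m)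
    (hθ : θ ∈ Θ) : g m + ρ / 2 * ‖m - θ‖ ^ 2 ≤ g θ := by
  have hsc : StrongConvexOn Set.univ ρ g := strongConvexOn_iff_convex.2 hg
  have hlim : Tendsto (fun t : ℝ => g m + (1 - t) * (ρ / 2 * ‖m - θ‖ ^ 2)) (𝓝[>] 0)
      (𝓝 (g m + ρ / 2 * ‖m - θ‖ ^ 2)) := by
    have hcont : Continuous fun t : ℝ => g m + (1 - t) * (ρ / 2 * ‖m - θ‖ ^ 2) := by fun_prop
    simpa using (hcont.tendsto 0).mono_left nhdsWithin_le_nhds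
  refine le_of_tendsto hlim ?_
  filter_upwards [Ioo_mem_nhdsGT (zero_lt_one (α := ℝ))] with t ht
  have h1t : 0 ≤ 1 - t := by linarith [ht.2]
  have hseg := hsc.2 (mem_univ m) (mem_univ θ) h1t ht.1.le (by ring)
  have hle := isMinOn_iff.1 hmin _ (hΘ hm hθ h1t ht.1.le (by ring))
  simp only [smul_eq_mul] at hseg
  refine le_of_mul_le_mul_left ?_ ht.1
  linarith

/-- Comparison of a surrogate's minimizer with an arbitrary point of the constraint set. -/
theorem Surrogate.add_sq_le {p : ℕ} {L ρ : ℝ} (hL : 0 ≤ L) {f g : E p → ℝ} {Θ : Set (E p)}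
    (hΘ : Convex ℝ Θ) {κ m θ : E p} (hs : Surrogate L f g Θ κ) (hg : StrongConvex ρ g)
    (hm : m ∈ Θ) (hmin : IsMinOn g Θ m) (hθ : θ ∈ Θ) :
    f m + ρ / 2 * ‖m - θ‖ ^ 2 ≤ f θ + L / 2 * ‖κ - θ‖ ^ 2 := by
  obtain ⟨hmaj, hsm, h0, hgrad⟩ := hs
  have hup := hsm.le_of_gradient_eq_zero hL h0 hgrad θ
  rw [norm_sub_rev κ θ]
  linarith [hmaj m hm hmin, hg.add_sq_le_of_isMinOn hΘ hm hmin hθ]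

/-- Proposition 2.8 (non-strongly convex case): for convex `f` and
`ρ`-strongly convex surrogates `gₙ ∈ S_{L,ρ}(f, θ_{n-1})` with `ρ ≥ L`,
`f(θₙ) - f* ≤ L‖θ₀ - θ*‖²/(2n)` for all `n ≥ 1`. -/
theorem mm_strong_surrogate_convex_rate {p : ℕ} (Θ : Set (E p)) (hΘ : Convex ℝ Θ)
    (L ρ : ℝ) (hL : 0 < L) (hρL : L ≤ ρ) (f : E p → ℝ)
    (hconv : ConvexOn ℝ Set.univ f)
    (hbdd : ∃ B, ∀ θ ∈ Θ, B ≤ f θ)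
    (θstar : E p) (hθstar : θstar ∈ Θ) (hminf : IsMinOn f Θ θstar)
    (θseq : ℕ → E p) (g : ℕ → E p → ℝ)
    (hθ0 : θseq 0 ∈ Θ)
    (hsur : ∀ n : ℕ, Surrogate L f (g (n+1)) Θ (θseq n))
    (hsc : ∀ n : ℕ, StrongConvex ρ (g (n+1)))
    (hmem : ∀ n : ℕ, θseq (n+1) ∈ Θ)
    (hmin : ∀ n : ℕ, IsMinOn (g (n+1)) Θ (θseq (n+1))) :
    ∀ n : ℕ, 1 ≤ n →
      f (θseq n) - f θstar ≤ L * ‖θseq 0 - θstar‖ ^ 2 / (2 * (n : ℝ)) := by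
  have hdesc (n : ℕ) : f (θseq (n + 1)) ≤ f (θseq n) := by
    have hn : θseq n ∈ Θ := by
      cases n with
      | zero => exact hθ0
      | succ k => exact hmem k
    have h := (hsur n).add_sq_le hL.le hΘ (hsc n) (hmem n) (hmin n) hn
    have hnn : 0 ≤ ρ / 2 * ‖θseq (n + 1) - θseq n‖ ^ 2 :=
      mul_nonneg (by linarith) (sq_nonneg _)
    simp only [sub_self, norm_zero] at h
    linarith
  have hpot (n : ℕ) : n * (f (θseq n) - f θstar) + L / 2 * ‖θseq n - θstar‖ ^ 2
      ≤ L / 2 * ‖θseq 0 - θstar‖ ^ 2 := by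
    induction n with
    | zero => simp
    | succ n ih =>
      have h := (hsur n).add_sq_le hL.le hΘ (hsc n) (hmem n) (hmin n) hθstar
      have hρ := mul_le_mul_of_nonneg_right hρL (sq_nonneg ‖θseq (n + 1) - θstar‖)
      have hn := mul_le_mul_of_nonneg_left (hdesc n) (Nat.cast_nonneg (α := ℝ) n)
      push_cast
      linarith
  intro n hn
  have hn' : (0 : ℝ) < n := by exact_mod_cast hn
  rw [le_div_iff₀ (by positivity)]
  have hnn : 0 ≤ L / 2 * ‖θseq n - θstar‖ ^ 2 := by positivity
  linarith [hpot n]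
end
end

section
/- Let f, g : ℝ^p → ℝ, and define h := g − f. If g and f are both μ-strongly convex and L-smooth for some L ≥ μ > 0, then h is (L − μ)-smooth, i.e., h is differentiable and its gradient is (L − μ)-Lipschitz continuous. -/
open MeasureTheory Filter Set
open scoped BigOperators NNReal Topology

noncomputable section

section SmoothConvex

variable {F : Type*} [NormedAddCommGroup F] [InnerProductSpace ℝ F]

/-- Two-sided quadratic bounds on the first-order Taylor remainder force the first-order
term to be Lipschitz. -/
theorem norm_sub_le_of_abs_taylor_le {h : F → ℝ} {h' : F → F} {M : ℝ}
    (hM : ∀ x d, |h (x + d) - h x - inner ℝ (h' x) d| ≤ M / 2 * ‖d‖ ^ 2) (x y : F) :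
    ‖h' x - h' y‖ ≤ M * ‖x - y‖ := by
  rcases eq_or_ne x y with rfl | hxy
  · simp
  rcases eq_or_ne (h' x - h' y) 0 with hG | hG
  · have hpos : 0 < ‖x - y‖ := norm_pos_iff.2 (sub_ne_zero.2 hxy)
    have hM0 : 0 ≤ M / 2 * ‖x - y‖ ^ 2 := (abs_nonneg _).trans (hM y (x - y))
    have : 0 ≤ M := by
      by_contra! hneg
      nlinarith [mul_pos (neg_pos.2 hneg) (pow_pos hpos 2)]
    rw [hG, norm_zero]
    positivity
  have hpos : 0 < ‖x - y‖ := norm_pos_iff.2 (sub_ne_zero.2 hxy)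
  set G := h' x - h' y with hGdef
  set w : F := (1 / 2 : ℝ) • (x - y) with hw
  set e : F := (‖x - y‖ / (2 * ‖G‖)) • G with he
  have hwn : ‖w‖ ^ 2 = ‖x - y‖ ^ 2 / 4 := by
    rw [hw, norm_smul, mul_pow]
    norm_num
    ring
  have hen : ‖e‖ ^ 2 = ‖x - y‖ ^ 2 / 4 := by
    rw [he, norm_smul, Real.norm_of_nonneg (by positivity)]
    field_simp
    norm_num
  have hGe : inner ℝ (h' x) e - inner ℝ (h' y) e = ‖G‖ * ‖x - y‖ / 2 := by
    rw [← inner_sub_left, ← hGdef, he, real_inner_smul_right, real_inner_self_eq_norm_sq]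
    field_simp
  have h₁ := abs_le.1 (hM x (-w + e))
  have h₂ := abs_le.1 (hM y (w + e))
  have h₃ := abs_le.1 (hM x (-w - e))
  have h₄ := abs_le.1 (hM y (w - e))
  have hxw : x = y + w + w := by
    rw [hw, add_assoc, ← add_smul]
    norm_num
  have hp : x + (-w + e) = y + (w + e) := by rw [hxw]; abel
  have hm : x + (-w - e) = y + (w - e) := by rw [hxw]; abel
  rw [hp] at h₁
  rw [hm] at h₃
  have hn₁ : ‖-w + e‖ ^ 2 = ‖w‖ ^ 2 - 2 * inner ℝ w e + ‖e‖ ^ 2 := by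
    rw [norm_add_sq_real, norm_neg, inner_neg_left]; ring
  have hn₃ : ‖-w - e‖ ^ 2 = ‖w‖ ^ 2 + 2 * inner ℝ w e + ‖e‖ ^ 2 := by
    rw [norm_sub_sq_real, norm_neg, inner_neg_left]; ring
  rw [hn₁, hwn, hen] at h₁
  rw [hn₃, hwn, hen] at h₃
  rw [norm_add_sq_real, hwn, hen] at h₂
  rw [norm_sub_sq_real, hwn, hen] at h₄
  simp only [inner_add_right, inner_sub_right, inner_neg_right] at h₁ h₂ h₃ h₄
  have key : ‖G‖ * ‖x - y‖ ≤ M * ‖x - y‖ * ‖x - y‖ := by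
    linarith [h₁.1, h₂.2, h₃.2, h₄.1]
  exact le_of_mul_le_mul_right key hpos

variable [CompleteSpace F]

theorem HasGradientAt.hasDerivAt_add_smul {f : F → ℝ} {f' x d : F} {t : ℝ}
    (h : HasGradientAt f f' (x + t • d)) :
    HasDerivAt (fun s : ℝ => f (x + s • d)) (inner ℝ f' d) t := by
  have hline : HasDerivAt (fun s : ℝ => x + s • d) d t := by
    simpa using ((hasDerivAt_id t).smul_const d).const_add x
  simpa [Function.comp_def] using h.hasFDerivAt.comp_hasDerivAt t hline

/-- First-order lower bound for a differentiable strongly convex function. -/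
theorem lower_bound_of_convexOn_sub_sq {f : F → ℝ} {μ : ℝ} (hf : Differentiable ℝ f)
    (hc : ConvexOn ℝ univ fun θ => f θ - μ / 2 * ‖θ‖ ^ 2) (x d : F) :
    f x + inner ℝ (gradient f x) d + μ / 2 * ‖d‖ ^ 2 ≤ f (x + d) := by
  have hconv : ConvexOn ℝ univ
      (fun t : ℝ => f (x + t • d) - μ / 2 * ‖x + t • d‖ ^ 2) := by
    have := hc.comp_affineMap (AffineMap.lineMap x (x + d))
    simpa [Function.comp_def, AffineMap.lineMap_apply, add_comm] using this
  have hline : HasDerivAt (fun s : ℝ => x + s • d) d 0 := by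
    simpa using ((hasDerivAt_id (0 : ℝ)).smul_const d).const_add x
  have hderiv : HasDerivAt (fun t : ℝ => f (x + t • d) - μ / 2 * ‖x + t • d‖ ^ 2)
      (inner ℝ (gradient f x) d - μ / 2 * (2 * inner ℝ x d)) 0 := by
    have h₁ : HasDerivAt (fun t : ℝ => f (x + t • d)) (inner ℝ (gradient f x) d) 0 :=
      HasGradientAt.hasDerivAt_add_smul (by simpa using (hf x).hasGradientAt)
    have h₂ := hline.norm_sq
    simp only [zero_smul, add_zero] at h₂
    exact h₁.sub (h₂.const_mul (μ / 2))
  have key := hconv.le_slope_of_hasDerivAt (mem_univ 0) (mem_univ 1) zero_lt_one hderiv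
  simp only [slope_def_field, one_smul, zero_smul, add_zero, sub_zero, div_one] at key
  rw [norm_add_sq_real] at key
  linarith

/-- The descent lemma. -/
theorem upper_bound_of_gradient_lipschitz {f : F → ℝ} {L : ℝ≥0} (hf : Differentiable ℝ f)
    (hL : LipschitzWith L (gradient f)) (x d : F) :
    f (x + d) ≤ f x + inner ℝ (gradient f x) d + L / 2 * ‖d‖ ^ 2 := by
  have hφ (t : ℝ) : HasDerivAt (fun s : ℝ => f (x + s • d))
      (inner ℝ (gradient f (x + t • d)) d) t :=
    (hf _).hasGradientAt.hasDerivAt_add_smul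
  have hB (t : ℝ) : HasDerivAt
      (fun s : ℝ => f x + s * inner ℝ (gradient f x) d + L / 2 * ‖d‖ ^ 2 * s ^ 2)
      (inner ℝ (gradient f x) d + L * ‖d‖ ^ 2 * t) t := by
    refine HasDerivAt.congr_deriv
      ((((hasDerivAt_id t).mul_const (inner ℝ (gradient f x) d)).const_add (f x)).add
        (((hasDerivAt_id t).pow 2).const_mul (L / 2 * ‖d‖ ^ 2))) ?_
    simp
    ring
  have key := image_le_of_deriv_right_le_deriv_boundary (a := 0) (b := 1)
    (fun t _ => (hφ t).continuousAt.continuousWithinAt)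
    (fun t _ => (hφ t).hasDerivWithinAt) (by simp)
    (fun t _ => (hB t).continuousAt.continuousWithinAt)
    (fun t _ => (hB t).hasDerivWithinAt) ?_ (right_mem_Icc.2 zero_le_one)
  · simpa using key
  · intro t ht
    have h₁ := real_inner_le_norm (gradient f (x + t • d) - gradient f x) d
    have h₂ := hL.norm_sub_le (x + t • d) x
    rw [add_sub_cancel_left, norm_smul, Real.norm_of_nonneg ht.1] at h₂
    rw [inner_sub_left] at h₁
    nlinarith [mul_le_mul_of_nonneg_right h₂ (norm_nonneg d)]

end SmoothConvex

/-- Lemma A.5 (iii): if `g` and `f` are `μ`-strongly convex and `L`-smooth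
with `L ≥ μ`, then `h := g - f` is `(L - μ)`-smooth, i.e. `h` is
differentiable and its gradient is `(L - μ)`-Lipschitz continuous. -/
theorem residual_smooth_strongly_convex {p : ℕ} (L μ : ℝ) (hμ : 0 < μ) (hμL : μ ≤ L)
    (f g : E p → ℝ)
    (hgsc : StrongConvex μ g) (hfsc : StrongConvex μ f)
    (hgsm : LSmooth L g) (hfsm : LSmooth L f) :
    LSmooth (L - μ) (fun θ => g θ - f θ) := by
  have hL : 0 ≤ L := hμ.le.trans hμL
  have hgrad : gradient (fun θ => g θ - f θ) = fun θ => gradient g θ - gradient f θ := by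
    refine gradient_eq fun θ => ?_
    rw [hasGradientAt_iff_hasFDerivAt, map_sub]
    exact (hgsm.1 θ).hasGradientAt.hasFDerivAt.sub (hfsm.1 θ).hasGradientAt.hasFDerivAt
  refine ⟨hgsm.1.sub hfsm.1, LipschitzWith.of_dist_le_mul fun x y => ?_⟩
  rw [dist_eq_norm, dist_eq_norm, Real.coe_toNNReal _ (sub_nonneg.2 hμL), hgrad]
  refine norm_sub_le_of_abs_taylor_le (h := fun θ => g θ - f θ)
    (h' := fun θ => gradient g θ - gradient f θ) (fun z d => ?_) x y
  have hgl := lower_bound_of_convexOn_sub_sq hgsm.1 hgsc z d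
  have hfl := lower_bound_of_convexOn_sub_sq hfsm.1 hfsc z d
  have hgu := upper_bound_of_gradient_lipschitz hgsm.1 hgsm.2 z d
  have hfu := upper_bound_of_gradient_lipschitz hfsm.1 hfsm.2 z d
  rw [Real.coe_toNNReal _ hL] at hgu hfu
  rw [inner_sub_left, abs_le]
  constructor <;> linarith
end
end

section
/- Let Θ₂ ⊆ ℝ^{p₂} be a nonempty closed convex set and f : ℝ^{p₁} × ℝ^{p₂} → ℝ satisfy: (i) θ₁ ↦ f(θ₁,θ₂) is differentiable for every θ₂ ∈ Θ₂; (ii) θ₂ ↦ ∇₁f(θ₁,θ₂) is L-Lipschitz continuous on Θ₂ for every θ₁ (where ∇₁ denotes the gradient with respect to the first variable); (iii) θ₂ ↦ f(θ₁,θ₂) is μ-strongly convex for every θ₁. Define f̃(θ₁) := min_{θ₂ ∈ Θ₂} f(θ₁,θ₂). Then f̃ is differentiable with ∇f̃(θ₁) = ∇₁f(θ₁, θ₂*(θ₁)), where θ₂*(θ₁) is the unique minimizer of θ₂ ↦ f(θ₁,θ₂) over Θ₂. Moreover, if additionally θ₁ ↦ ∇₁f(θ₁,θ₂) is L'-Lipschitz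 continuous for every θ₂ ∈ Θ₂, then ∇f̃ is (L' + L²/μ)-Lipschitz continuous. -/
open MeasureTheory Filter Set
open scoped BigOperators NNReal Topology

noncomputable section

/-- A minimizer of a strongly convex function has quadratic growth around it. -/
theorem StrongConvexOn.quadratic_growth {F : Type*} [NormedAddCommGroup F] [NormedSpace ℝ F]
    {s : Set F} {μ : ℝ} {g : F → ℝ} (hg : StrongConvexOn s μ g) {m y : F} (hm : m ∈ s)
    (hmin : IsMinOn g s m) (hy : y ∈ s) : μ / 2 * ‖m - y‖ ^ 2 ≤ g y - g m := by
  have key : ∀ t : ℝ, 0 < t → t < 1 → (1 - t) * (μ / 2 * ‖m - y‖ ^ 2) ≤ g y - g m := by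
    intro t ht0 ht1
    have h1 := hg.2 hm hy (sub_nonneg.2 ht1.le) ht0.le (sub_add_cancel 1 t)
    have h2 : g m ≤ g ((1 - t) • m + t • y) :=
      hmin (hg.1 hm hy (sub_nonneg.2 ht1.le) ht0.le (sub_add_cancel 1 t))
    simp only [smul_eq_mul] at h1
    refine le_of_mul_le_mul_left ?_ ht0
    linarith
  have hlim : Tendsto (fun t : ℝ => (1 - t) * (μ / 2 * ‖m - y‖ ^ 2)) (𝓝[>] 0)
      (𝓝 ((1 - 0) * (μ / 2 * ‖m - y‖ ^ 2))) :=
    ((continuous_const.sub continuous_id).mul continuous_const).continuousAt.mono_left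
      nhdsWithin_le_nhds
  rw [sub_zero, one_mul] at hlim
  refine le_of_tendsto hlim ?_
  filter_upwards [Ioo_mem_nhdsGT (zero_lt_one' ℝ)] with t ht using key t ht.1 ht.2

/-- A strongly convex function on a finite-dimensional inner product space attains its minimum on
every nonempty closed set. -/
theorem StrongConvexOn.exists_isMinOn {F : Type*} [NormedAddCommGroup F] [InnerProductSpace ℝ F]
    [FiniteDimensional ℝ F] {μ : ℝ} (hμ : 0 < μ) {g : F → ℝ} (hg : StrongConvexOn univ μ g)
    {s : Set F} (hs : IsClosed s) (hne : s.Nonempty) : ∃ m ∈ s, IsMinOn g s m := by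
  have hcvx := strongConvexOn_iff_convex.1 hg
  have hcont : Continuous g := by
    have h : Continuous fun x : F => μ / 2 * ‖x‖ ^ 2 := by fun_prop
    exact (hcvx.locallyLipschitz.continuous.add h).congr fun x => sub_add_cancel _ _
  obtain ⟨l, c, hl, -⟩ := hcvx.exists_affine_le_of_lt (𝕜 := ℝ) (mem_univ 0)
    (sub_one_lt _) isClosed_univ
    (hcvx.locallyLipschitz.continuous.lowerSemicontinuous.lowerSemicontinuousOn _)
  have hbound : ∀ x, ‖x‖ * (μ / 2 * ‖x‖ - ‖l‖) + c ≤ g x := by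
    intro x
    have h1 : l x + c ≤ g x - μ / 2 * ‖x‖ ^ 2 := hl ⟨x, mem_univ x⟩
    have h2 := (abs_le.1 (l.le_opNorm x)).1
    linarith
  have hcoer : Tendsto g (cocompact F) atTop := by
    refine tendsto_atTop_mono hbound (tendsto_atTop_add_const_right _ _ ?_)
    have hn := tendsto_norm_cocompact_atTop (E := F)
    exact hn.atTop_mul_atTop₀
      (tendsto_atTop_add_const_right _ (-‖l‖) (hn.const_mul_atTop (half_pos hμ)))
  obtain ⟨x₀, hx₀⟩ := hne
  exact hcont.continuousOn.exists_isMinOn' hs hx₀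
    ((hcoer.eventually_ge_atTop (g x₀)).filter_mono inf_le_left)

theorem StrongConvexOn.existsUnique_isMinOn {F : Type*} [NormedAddCommGroup F]
    [InnerProductSpace ℝ F] [FiniteDimensional ℝ F] {μ : ℝ} (hμ : 0 < μ) {g : F → ℝ}
    (hg : StrongConvexOn univ μ g) {s : Set F} (hs : IsClosed s) (hconv : Convex ℝ s)
    (hne : s.Nonempty) : ∃! m, m ∈ s ∧ IsMinOn g s m := by
  obtain ⟨m, hm, hmin⟩ := hg.exists_isMinOn hμ hs hne
  refine ⟨m, ⟨hm, hmin⟩, fun y hy => ?_⟩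
  have hsub : StrictConvexOn ℝ s g := (hg.strictConvexOn hμ).subset (subset_univ s) hconv
  exact hsub.eq_of_isMinOn hy.2 hmin hy.1 hm

theorem IsMinOn.sInf_image_eq {α : Type*} {g : α → ℝ} {s : Set α} {m : α} (hmin : IsMinOn g s m)
    (hm : m ∈ s) : sInf (g '' s) = g m :=
  IsLeast.csInf_eq ⟨mem_image_of_mem g hm, forall_mem_image.2 fun _ hy => hmin hy⟩

/-- If the gradients of two differentiable functions are uniformly `C`-close, then their difference
is `C`-Lipschitz. -/
theorem abs_sub_sub_sub_le_of_norm_gradient_sub_le {F : Type*} [NormedAddCommGroup F]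
    [InnerProductSpace ℝ F] [CompleteSpace F] {g h : F → ℝ} (hg : Differentiable ℝ g)
    (hh : Differentiable ℝ h) {C : ℝ} (hC : ∀ x, ‖gradient g x - gradient h x‖ ≤ C) (x y : F) :
    |(g y - h y) - (g x - h x)| ≤ C * ‖y - x‖ := by
  refine convex_univ.norm_image_sub_le_of_norm_hasFDerivWithin_le (𝕜 := ℝ)
    (f := fun z => g z - h z)
    (fun z _ => ((hg z).hasGradientAt.hasFDerivAt.sub
      (hh z).hasGradientAt.hasFDerivAt).hasFDerivWithinAt) (fun z _ => ?_) (mem_univ x) (mem_univ y)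
  rw [← map_sub, LinearIsometryEquiv.norm_map]
  exact hC z

/-- A function which agrees with `g` up to a quadratic error at `x` has the same gradient. -/
theorem HasGradientAt.of_abs_sub_le_sq {F : Type*} [NormedAddCommGroup F]
    [InnerProductSpace ℝ F] [CompleteSpace F] {g h : F → ℝ} {g' x : F} (hg : HasGradientAt g g' x)
    {C : ℝ} (hC : ∀ y, |h y - g y| ≤ C * ‖y - x‖ ^ 2) : HasGradientAt h g' x := by
  have hx : h x = g x := by simpa [sub_eq_zero] using hC x
  rw [hasGradientAt_iff_isLittleO] at hg ⊢
  have hO : (fun y => h y - g y) =O[𝓝 x] fun y => ‖y - x‖ ^ 2 :=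
    Asymptotics.IsBigO.of_bound C (Eventually.of_forall fun y => by simpa using hC y)
  have ho : (fun y => h y - g y) =o[𝓝 x] fun y => y - x :=
    hO.trans_isLittleO (Asymptotics.isLittleO_pow_sub_sub x one_lt_two)
  refine (hg.add ho).congr_left fun y => ?_
  rw [hx]
  ring

section OptimalValue

variable {F G : Type*} [NormedAddCommGroup F] [InnerProductSpace ℝ F] [CompleteSpace F]
  [NormedAddCommGroup G] [NormedSpace ℝ G] {s : Set G} {L μ : ℝ} {f : F → G → ℝ}

/-- The partial minimizer of a function strongly convex in its second variable depends Lipschitz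
continuously on the first variable. -/
theorem norm_sub_le_of_isMinOn (hL : 0 ≤ L) (hμ : 0 < μ)
    (hdiff : ∀ b ∈ s, Differentiable ℝ fun a => f a b)
    (hlip : ∀ a, ∀ b ∈ s, ∀ c ∈ s,
      ‖gradient (fun x => f x b) a - gradient (fun x => f x c) a‖ ≤ L * ‖b - c‖)
    (hsc : ∀ a, StrongConvexOn s μ (f a)) {x y : F} {m n : G} (hm : m ∈ s)
    (hmin : IsMinOn (f x) s m) (hn : n ∈ s) (hnin : IsMinOn (f y) s n) :
    ‖m - n‖ ≤ L / μ * ‖x - y‖ := by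
  have h1 := (hsc x).quadratic_growth hm hmin hn
  have h2 := (hsc y).quadratic_growth hn hnin hm
  have h3 := (abs_le.1 (abs_sub_sub_sub_le_of_norm_gradient_sub_le (hdiff n hn) (hdiff m hm)
    (fun a => hlip a n hn m hm) y x)).2
  rw [norm_sub_rev n m] at h2 h3
  rcases (norm_nonneg (m - n)).eq_or_lt with h0 | h0
  · rw [← h0]
    positivity
  · rw [div_mul_eq_mul_div, le_div_iff₀ hμ]
    refine le_of_mul_le_mul_left ?_ h0
    linarith

/-- Partial minimization differs from the section at the minimizer by a quadratic error. -/
theorem abs_sub_le_sq_of_isMinOn (hL : 0 ≤ L) (hμ : 0 < μ)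
    (hdiff : ∀ b ∈ s, Differentiable ℝ fun a => f a b)
    (hlip : ∀ a, ∀ b ∈ s, ∀ c ∈ s,
      ‖gradient (fun x => f x b) a - gradient (fun x => f x c) a‖ ≤ L * ‖b - c‖)
    (hsc : ∀ a, StrongConvexOn s μ (f a)) {x y : F} {m n : G} (hm : m ∈ s)
    (hmin : IsMinOn (f x) s m) (hn : n ∈ s) (hnin : IsMinOn (f y) s n) :
    |f y n - f y m| ≤ L ^ 2 / μ * ‖y - x‖ ^ 2 := by
  have h1 : f x m ≤ f x n := hmin hn
  have h2 : f y n ≤ f y m := hnin hm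
  have h3 := (abs_le.1 (abs_sub_sub_sub_le_of_norm_gradient_sub_le (hdiff n hn) (hdiff m hm)
    (fun a => hlip a n hn m hm) x y)).1
  have h4 := norm_sub_le_of_isMinOn hL hμ hdiff hlip hsc hn hnin hm hmin
  have h5 : L * ‖n - m‖ * ‖y - x‖ ≤ L * (L / μ * ‖y - x‖) * ‖y - x‖ := by gcongr
  have h6 : L * (L / μ * ‖y - x‖) * ‖y - x‖ = L ^ 2 / μ * ‖y - x‖ ^ 2 := by ring
  rw [abs_of_nonpos (by linarith)]
  linarith

/-- The gradient of the optimal value function is the partial gradient at the minimizer. -/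
theorem hasGradientAt_sInf_image (hL : 0 ≤ L) (hμ : 0 < μ)
    (hdiff : ∀ b ∈ s, Differentiable ℝ fun a => f a b)
    (hlip : ∀ a, ∀ b ∈ s, ∀ c ∈ s,
      ‖gradient (fun x => f x b) a - gradient (fun x => f x c) a‖ ≤ L * ‖b - c‖)
    (hsc : ∀ a, StrongConvexOn s μ (f a)) (hex : ∀ a, ∃ m ∈ s, IsMinOn (f a) s m)
    {x : F} {m : G} (hm : m ∈ s) (hmin : IsMinOn (f x) s m) :
    HasGradientAt (fun a => sInf (f a '' s)) (gradient (fun a => f a m) x) x := by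
  refine (hdiff m hm x).hasGradientAt.of_abs_sub_le_sq (C := L ^ 2 / μ) fun y => ?_
  obtain ⟨n, hn, hnin⟩ := hex y
  rw [hnin.sInf_image_eq hn]
  exact abs_sub_le_sq_of_isMinOn hL hμ hdiff hlip hsc hm hmin hn hnin

end OptimalValue

/-- Lemma A.6 (regularity of optimal value functions): under differentiability
in `θ₁`, `L`-Lipschitzness of `θ₂ ↦ ∇₁f(θ₁,θ₂)` on `Θ₂`, and `μ`-strong
convexity in `θ₂`, the value function `f̃(θ₁) = min_{θ₂ ∈ Θ₂} f(θ₁,θ₂)` is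
differentiable with `∇f̃(θ₁) = ∇₁f(θ₁, θ₂*(θ₁))` where `θ₂*(θ₁)` is the
unique minimizer; if moreover `θ₁ ↦ ∇₁f(θ₁,θ₂)` is `L'`-Lipschitz for every
`θ₂ ∈ Θ₂`, then `∇f̃` is `(L' + L²/μ)`-Lipschitz. -/
theorem optimal_value_regularity {p₁ p₂ : ℕ}
    (Θ₂ : Set (E p₂)) (hne : Θ₂.Nonempty) (hcl : IsClosed Θ₂) (hconv : Convex ℝ Θ₂)
    (L L' μ : ℝ) (hL : 0 < L) (hL' : 0 < L') (hμ : 0 < μ)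
    (f : E p₁ → E p₂ → ℝ)
    (hdiff : ∀ θ₂ ∈ Θ₂, Differentiable ℝ (fun θ₁ => f θ₁ θ₂))
    (hlip : ∀ θ₁ : E p₁,
      LipschitzOnWith L.toNNReal (fun θ₂ => gradient (fun x => f x θ₂) θ₁) Θ₂)
    (hsc : ∀ θ₁ : E p₁, StrongConvex μ (f θ₁)) :
    (∀ θ₁ : E p₁, ∃! m, m ∈ Θ₂ ∧ IsMinOn (f θ₁) Θ₂ m) ∧
    Differentiable ℝ (fun θ₁ => sInf (f θ₁ '' Θ₂)) ∧
    (∀ θ₁ : E p₁, ∀ m ∈ Θ₂, IsMinOn (f θ₁) Θ₂ m →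
      gradient (fun x => sInf (f x '' Θ₂)) θ₁ = gradient (fun x => f x m) θ₁) ∧
    ((∀ θ₂ ∈ Θ₂,
        LipschitzWith L'.toNNReal (fun θ₁ => gradient (fun x => f x θ₂) θ₁)) →
      LipschitzWith (L' + L ^ 2 / μ).toNNReal
        (gradient (fun θ₁ => sInf (f θ₁ '' Θ₂)))) := by
  have hsc' : ∀ a, StrongConvexOn univ μ (f a) := fun a => strongConvexOn_iff_convex.2 (hsc a)
  have hscΘ : ∀ a, StrongConvexOn Θ₂ μ (f a) := fun a =>
    ⟨hconv, fun _ _ _ _ => (hsc' a).2 (mem_univ _) (mem_univ _)⟩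
  have hex : ∀ a, ∃ m ∈ Θ₂, IsMinOn (f a) Θ₂ m := fun a => (hsc' a).exists_isMinOn hμ hcl hne
  have hlip' : ∀ a, ∀ b ∈ Θ₂, ∀ c ∈ Θ₂,
      ‖gradient (fun x => f x b) a - gradient (fun x => f x c) a‖ ≤ L * ‖b - c‖ := by
    intro a b hb c hc
    simpa [dist_eq_norm, hL.le] using (hlip a).dist_le_mul b hb c hc
  have hgrad : ∀ {x : E p₁} {m : E p₂}, m ∈ Θ₂ → IsMinOn (f x) Θ₂ m →
      HasGradientAt (fun a => sInf (f a '' Θ₂)) (gradient (fun a => f a m) x) x :=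
    hasGradientAt_sInf_image hL.le hμ hdiff hlip' hscΘ hex
  refine ⟨fun a => (hsc' a).existsUnique_isMinOn hμ hcl hconv hne, fun x => ?_,
    fun x m hm hmin => (hgrad hm hmin).gradient, fun hlip₁ => ?_⟩
  · obtain ⟨m, hm, hmin⟩ := hex x
    exact (hgrad hm hmin).differentiableAt
  · refine LipschitzWith.of_dist_le_mul fun x y => ?_
    obtain ⟨m, hm, hmin⟩ := hex x
    obtain ⟨n, hn, hnin⟩ := hex y
    rw [(hgrad hm hmin).gradient, (hgrad hn hnin).gradient, Real.coe_toNNReal _ (by positivity)]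
    have h1 := (hlip₁ m hm).dist_le_mul x y
    rw [Real.coe_toNNReal _ hL'.le] at h1
    have h2 := hlip' y m hm n hn
    have h3 := norm_sub_le_of_isMinOn hL.le hμ hdiff hlip' hscΘ hm hmin hn hnin
    rw [← dist_eq_norm] at h2
    rw [← dist_eq_norm x y] at h3
    calc dist (gradient (fun a => f a m) x) (gradient (fun a => f a n) y)
        ≤ L' * dist x y + L * (L / μ * dist x y) :=
          (dist_triangle _ (gradient (fun a => f a m) y) _).trans
            (add_le_add h1 (h2.trans (by gcongr)))
      _ = (L' + L ^ 2 / μ) * dist x y := by ring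
end
end

section
/- Let Θ₁ ⊆ ℝ^{p₁} be convex and Θ₂ ⊆ ℝ^{p₂} be a nonempty closed convex set, and let f : ℝ^{p₁} × ℝ^{p₂} → ℝ satisfy: (i) θ₂ ↦ f(θ₁,θ₂) is μ-strongly convex for every θ₁ ∈ ℝ^{p₁}; (ii) θ₁ ↦ f(θ₁,θ₂) is differentiable for every θ₂ ∈ Θ₂; (iii) (θ₁,θ₂) ↦ ∇₁f(θ₁,θ₂) is L'-Lipschitz with respect to θ₁ and L-Lipschitz with respect to θ₂. Define f̃(θ₁) := min_{θ₂ ∈ Θ₂} f(θ₁,θ₂). Fix κ₁ ∈ Θ₁ and let κ₂* be the minimizer of θ₂ ↦ f(κ₁,θ₂) over Θ₂, and define g(θ₁) := f(θ₁, κ₂*). Then g is a majorizing first-order surrogate of f̃ near κ₁ in Θ₁ with parameter L'' := 2L' + L²/μ; that is, g(θ₁) ≥ f̃(θ₁) for all θ₁, and the error h := g − f̃ is (2L' + L²/μ)-smooth with h(κ₁) = 0 and ∇h(κ₁) = 0. -/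
open MeasureTheory Filter Set
open scoped BigOperators NNReal Topology

noncomputable section

section Gradient

variable {F : Type*} [NormedAddCommGroup F] [InnerProductSpace ℝ F] [CompleteSpace F]

/-- First-order Taylor estimate for a function whose gradient stays within `C` of `v`
on a convex set. -/
theorem abs_sub_sub_inner_le_of_norm_gradient_sub_le {f : F → ℝ} {f' : F → F} {s : Set F}
    (hs : Convex ℝ s) (hf : ∀ z ∈ s, HasGradientAt f (f' z) z) {v : F} {C : ℝ}
    (hC : ∀ z ∈ s, ‖f' z - v‖ ≤ C) {x y : F} (hx : x ∈ s) (hy : y ∈ s) :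
    |f y - f x - inner ℝ v (y - x)| ≤ C * ‖y - x‖ := by
  have h := hs.norm_image_sub_le_of_norm_hasFDerivWithin_le' (f := f)
    (f' := fun z => InnerProductSpace.toDual ℝ F (f' z)) (φ := InnerProductSpace.toDual ℝ F v)
    (fun z hz => (hf z hz).hasFDerivAt.hasFDerivWithinAt)
    (fun z hz => by rw [← map_sub, LinearIsometryEquiv.norm_map]; exact hC z hz) hx hy
  simpa [Real.norm_eq_abs] using h

theorem abs_sub_sub_inner_gradient_le {f : F → ℝ} (hf : Differentiable ℝ f) {K : ℝ≥0}
    (hK : LipschitzWith K (gradient f)) (x y : F) :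
    |f y - f x - inner ℝ (gradient f x) (y - x)| ≤ K * ‖y - x‖ ^ 2 := by
  have h := abs_sub_sub_inner_le_of_norm_gradient_sub_le (f := f) (f' := gradient f)
    (C := K * ‖y - x‖) (convex_closedBall x ‖y - x‖)
    (fun z _ => (hf z).hasGradientAt) (v := gradient f x)
    (fun z hz => (hK.norm_sub_le z x).trans (by
      have := mem_closedBall_iff_norm.1 hz
      gcongr))
    (Metric.mem_closedBall_self (norm_nonneg _)) (mem_closedBall_iff_norm.2 le_rfl)
  simpa [pow_two, mul_assoc] using h

theorem hasGradientAt_of_abs_sub_sub_inner_le {f : F → ℝ} {v x : F} {C : ℝ}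
    (h : ∀ y, |f y - f x - inner ℝ v (y - x)| ≤ C * ‖y - x‖ ^ 2) : HasGradientAt f v x := by
  rw [hasGradientAt_iff_isLittleO]
  refine (Asymptotics.IsBigO.of_bound (g := fun y => ‖y - x‖ ^ 2) C
    (Eventually.of_forall fun y => ?_)).trans_isLittleO ?_
  · simpa using h y
  · exact Asymptotics.isLittleO_pow_sub_sub x one_lt_two

end Gradient

section StrongConvex

variable {G : Type*} [NormedAddCommGroup G] [InnerProductSpace ℝ G]

/-- Quadratic growth of a strongly convex function away from a minimizer. -/
theorem StrongConvexOn.add_sq_le_of_isMinOn_s19 {s : Set G} {f : G → ℝ} {m : ℝ}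
    (hf : StrongConvexOn s m f) {u z : G} (hu : u ∈ s) (hmin : IsMinOn f s u) (hz : z ∈ s) :
    f u + m / 2 * ‖z - u‖ ^ 2 ≤ f z := by
  by_contra! hlt
  set M := m / 2 * ‖z - u‖ ^ 2 with hM
  have hc : f u ≤ f z := hmin hz
  have hMpos : 0 < M := by linarith
  set t := (M - (f z - f u)) / (2 * M) with ht
  have htM : t * M = (M - (f z - f u)) / 2 := by rw [ht]; field_simp
  have ht0 : 0 < t := by rw [ht]; apply div_pos <;> linarith
  have ht1 : t < 1 := by rw [ht, div_lt_one (by linarith)]; linarith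
  have h1 := hf.2 hz hu ht0.le (sub_nonneg.2 ht1.le) (by ring)
  have h2 : f u ≤ f (t • z + (1 - t) • u) :=
    hmin (hf.1 hz hu ht0.le (sub_nonneg.2 ht1.le) (by ring))
  simp only [smul_eq_mul, ← hM] at h1
  have h3 : 0 ≤ t * ((f z - f u) - (1 - t) * M) := by linarith
  have h4 := nonneg_of_mul_nonneg_right h3 ht0
  linarith

/-- A strongly convex function attains its minimum on every nonempty closed set. -/
theorem StrongConvexOn.exists_isMinOn_of_isClosed [FiniteDimensional ℝ G] {f : G → ℝ} {m : ℝ}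
    (hm : 0 < m) (hf : StrongConvexOn univ m f) {s : Set G} (hs : IsClosed s)
    (hne : s.Nonempty) : ∃ u ∈ s, IsMinOn f s u := by
  obtain ⟨a, ha⟩ := hne
  have hconv : ConvexOn ℝ univ f := by
    refine UniformConvexOn.convexOn hf fun r => ?_
    dsimp only [Pi.zero_apply]
    positivity
  have hcont : Continuous f := by
    rw [← continuousOn_univ]
    simpa using hconv.continuousOn_interior
  obtain ⟨c, hc⟩ := (isCompact_sphere a 1).bddBelow_image hcont.continuousOn
  have key : ∀ z, 1 + 2 / m * (f a - c) < ‖z - a‖ → 1 ≤ ‖z - a‖ → f a ≤ f z := by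
    intro z hz hz1
    set r := ‖z - a‖ with hr
    have hr0 : 0 < r := by linarith
    have h1 := hf.2 (mem_univ z) (mem_univ a) (inv_nonneg.2 hr0.le)
      (sub_nonneg.2 (inv_le_one_of_one_le₀ hz1)) (by ring)
    have h2 : c ≤ f (r⁻¹ • z + (1 - r⁻¹) • a) := by
      refine hc ⟨_, ?_, rfl⟩
      rw [mem_sphere_iff_norm]
      have : r⁻¹ • z + (1 - r⁻¹) • a - a = r⁻¹ • (z - a) := by module
      rw [this, norm_smul, norm_inv, norm_norm, ← hr]
      exact inv_mul_cancel₀ hr0.ne'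
    simp only [smul_eq_mul, ← hr] at h1
    have h3 : r * c ≤ f z + (r - 1) * f a - m / 2 * (r - 1) * r := by
      calc r * c ≤ r * (r⁻¹ * f z + (1 - r⁻¹) * f a - r⁻¹ * (1 - r⁻¹) * (m / 2 * r ^ 2)) := by
            gcongr; exact h2.trans h1
        _ = _ := by field_simp
    have h4 : f a - c < m / 2 * (r - 1) := by
      have : m / 2 * (2 / m * (f a - c)) = f a - c := by field_simp
      nlinarith
    nlinarith
  refine hcont.continuousOn.exists_isMinOn' hs ha (Filter.Eventually.filter_mono inf_le_left ?_)
  have : ProperSpace G := FiniteDimensional.proper ℝ G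
  have h := tendsto_dist_right_cocompact_atTop a
  filter_upwards [h.eventually_gt_atTop (1 + 2 / m * (f a - c)), h.eventually_ge_atTop 1]
    with z hz hz1
  rw [dist_eq_norm] at hz hz1
  exact key z hz hz1

end StrongConvex

section MinimalValue

variable {F G : Type*} [NormedAddCommGroup F] [InnerProductSpace ℝ F] [CompleteSpace F]
  [NormedAddCommGroup G] [InnerProductSpace ℝ G]
  {f : F → G → ℝ} {s : Set G} {m : ℝ} {K K' : ℝ≥0} {u : F → G}

/-- The minimizer of a strongly convex function depends in a Lipschitz way on a parameter. -/
theorem norm_minimizer_sub_le (hm : 0 < m) (hsc : ∀ x, StrongConvexOn s m (f x))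
    (hdiff : ∀ z ∈ s, Differentiable ℝ fun x => f x z)
    (hlip : ∀ x, LipschitzWith K fun z => gradient (fun y => f y z) x)
    (hu : ∀ x, u x ∈ s) (hmin : ∀ x, IsMinOn (f x) s (u x)) (x y : F) :
    ‖u y - u x‖ ≤ K / m * ‖y - x‖ := by
  rcases (norm_nonneg (u y - u x)).eq_or_lt with h0 | hpos
  · rw [← h0]; positivity
  have h1 := (hsc x).add_sq_le_of_isMinOn_s19 (hu x) (hmin x) (hu y)
  have h2 := (hsc y).add_sq_le_of_isMinOn_s19 (hu y) (hmin y) (hu x)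
  rw [norm_sub_rev] at h2
  have h3 := abs_sub_sub_inner_le_of_norm_gradient_sub_le
    (f := fun w => f w (u y) - f w (u x))
    (f' := fun z => gradient (fun w => f w (u y)) z - gradient (fun w => f w (u x)) z)
    (v := 0) (C := K * ‖u y - u x‖) convex_univ
    (fun z _ => by
      rw [hasGradientAt_iff_hasFDerivAt, map_sub]
      exact (hdiff _ (hu y) z).hasGradientAt.hasFDerivAt.sub
        (hdiff _ (hu x) z).hasGradientAt.hasFDerivAt)
    (fun z _ => by simpa using (hlip z).norm_sub_le (u y) (u x)) (mem_univ x) (mem_univ y)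
  rw [inner_zero_left, sub_zero] at h3
  have h4 := (abs_le.1 h3).1
  have h5 : ‖u y - u x‖ * (m * ‖u y - u x‖) ≤ ‖u y - u x‖ * (K * ‖y - x‖) := by linarith
  have h6 := le_of_mul_le_mul_left h5 hpos
  rw [div_mul_eq_mul_div, le_div_iff₀ hm]
  linarith

/-- Danskin's formula: the gradient of the minimal value is the partial gradient at
the minimizer. -/
theorem hasGradientAt_minimalValue (hm : 0 < m) (hsc : ∀ x, StrongConvexOn s m (f x))
    (hdiff : ∀ z ∈ s, Differentiable ℝ fun x => f x z)
    (hlip' : ∀ z ∈ s, LipschitzWith K' (gradient fun x => f x z))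
    (hlip : ∀ x, LipschitzWith K fun z => gradient (fun y => f y z) x)
    (hu : ∀ x, u x ∈ s) (hmin : ∀ x, IsMinOn (f x) s (u x)) (x : F) :
    HasGradientAt (fun x => f x (u x)) (gradient (fun y => f y (u x)) x) x := by
  refine hasGradientAt_of_abs_sub_sub_inner_le (C := K' + K * (K / m)) fun y => ?_
  have hux := abs_le.1 (abs_sub_sub_inner_gradient_le (hdiff _ (hu x)) (hlip' _ (hu x)) x y)
  have huy := abs_le.1 (abs_sub_sub_inner_gradient_le (hdiff _ (hu y)) (hlip' _ (hu y)) x y)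
  have hmy : f y (u y) ≤ f y (u x) := hmin y (hu x)
  have hmx : f x (u x) ≤ f x (u y) := hmin x (hu y)
  have hin : |inner ℝ (gradient (fun z => f z (u y)) x) (y - x)
      - inner ℝ (gradient (fun z => f z (u x)) x) (y - x)| ≤ K * (K / m) * ‖y - x‖ ^ 2 := by
    rw [← inner_sub_left]
    calc _ ≤ _ := abs_real_inner_le_norm _ _
      _ ≤ K * (K / m * ‖y - x‖) * ‖y - x‖ := by
        gcongr
        refine ((hlip x).norm_sub_le (u y) (u x)).trans ?_
        gcongr
        exact norm_minimizer_sub_le hm hsc hdiff hlip hu hmin x y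
      _ = _ := by ring
  have hin' := (abs_le.1 hin).1
  have hnn : 0 ≤ K * (K / m) * ‖y - x‖ ^ 2 := by positivity
  rw [add_mul, abs_le]
  constructor <;> linarith [hux.1, hux.2, huy.1, huy.2]

/-- The partial gradient at the minimizer is Lipschitz in the parameter. -/
theorem norm_gradient_minimizer_sub_le (hm : 0 < m) (hsc : ∀ x, StrongConvexOn s m (f x))
    (hdiff : ∀ z ∈ s, Differentiable ℝ fun x => f x z)
    (hlip' : ∀ z ∈ s, LipschitzWith K' (gradient fun x => f x z))
    (hlip : ∀ x, LipschitzWith K fun z => gradient (fun y => f y z) x)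
    (hu : ∀ x, u x ∈ s) (hmin : ∀ x, IsMinOn (f x) s (u x)) (x y : F) :
    ‖gradient (fun z => f z (u y)) y - gradient (fun z => f z (u x)) x‖
      ≤ (K' + K ^ 2 / m) * ‖y - x‖ := by
  calc _ ≤ ‖gradient (fun z => f z (u y)) y - gradient (fun z => f z (u x)) y‖
        + ‖gradient (fun z => f z (u x)) y - gradient (fun z => f z (u x)) x‖ :=
        norm_sub_le_norm_sub_add_norm_sub _ _ _
    _ ≤ K * (K / m * ‖y - x‖) + K' * ‖y - x‖ := by
        gcongr
        · refine ((hlip y).norm_sub_le (u y) (u x)).trans ?_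
          gcongr
          exact norm_minimizer_sub_le hm hsc hdiff hlip hu hmin x y
        · exact (hlip' _ (hu x)).norm_sub_le y x
    _ = _ := by ring

end MinimalValue

/-- The variational surrogate (Section 2.3.4): with `f(·,θ₂)` differentiable,
`f(θ₁,·)` `μ`-strongly convex, `∇₁f` `L'`-Lipschitz in `θ₁` and `L`-Lipschitz
in `θ₂`, the function `g(θ₁) := f(θ₁, κ₂*)` — where `κ₂*` minimizes
`f(κ₁,·)` over `Θ₂` — is a majorizing first-order surrogate of
`f̃(θ₁) = min_{θ₂ ∈ Θ₂} f(θ₁,θ₂)` near `κ₁` with parameter `2L' + L²/μ`. -/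
theorem variational_surrogate {p₁ p₂ : ℕ}
    (Θ₁ : Set (E p₁)) (hΘ₁ : Convex ℝ Θ₁)
    (Θ₂ : Set (E p₂)) (hne : Θ₂.Nonempty) (hcl : IsClosed Θ₂) (hconv : Convex ℝ Θ₂)
    (L L' μ : ℝ) (hL : 0 < L) (hL' : 0 < L') (hμ : 0 < μ)
    (f : E p₁ → E p₂ → ℝ)
    (hsc : ∀ θ₁ : E p₁, StrongConvex μ (f θ₁))
    (hdiff : ∀ θ₂ ∈ Θ₂, Differentiable ℝ (fun θ₁ => f θ₁ θ₂))
    (hlip1 : ∀ θ₂ ∈ Θ₂,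
      LipschitzWith L'.toNNReal (fun θ₁ => gradient (fun x => f x θ₂) θ₁))
    (hlip2 : ∀ θ₁ : E p₁,
      LipschitzWith L.toNNReal (fun θ₂ => gradient (fun x => f x θ₂) θ₁))
    (κ₁ : E p₁) (hκ₁ : κ₁ ∈ Θ₁)
    (κ₂star : E p₂) (hκ₂mem : κ₂star ∈ Θ₂) (hκ₂min : IsMinOn (f κ₁) Θ₂ κ₂star) :
    (∀ θ₁ : E p₁, sInf (f θ₁ '' Θ₂) ≤ f θ₁ κ₂star) ∧
    LSmooth (2 * L' + L ^ 2 / μ) (fun θ₁ => f θ₁ κ₂star - sInf (f θ₁ '' Θ₂)) ∧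
    f κ₁ κ₂star - sInf (f κ₁ '' Θ₂) = 0 ∧
    gradient (fun θ₁ => f θ₁ κ₂star - sInf (f θ₁ '' Θ₂)) κ₁ = 0 := by
  have hsc' : ∀ x, StrongConvexOn Θ₂ μ (f x) := fun x => by
    rw [strongConvexOn_iff_convex]
    exact (hsc x).subset (subset_univ _) hconv
  have hex : ∀ x, ∃ z ∈ Θ₂, IsMinOn (f x) Θ₂ z := fun x =>
    (strongConvexOn_iff_convex.2 (hsc x)).exists_isMinOn_of_isClosed hμ hcl hne
  choose u hu hmin using hex
  have hsInf : ∀ x, sInf (f x '' Θ₂) = f x (u x) := fun x =>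
    IsLeast.csInf_eq ⟨mem_image_of_mem _ (hu x), forall_mem_image.2 (hmin x)⟩
  have huκ : u κ₁ = κ₂star := by
    have h := (hsc' κ₁).add_sq_le_of_isMinOn_s19 (hu κ₁) (hmin κ₁) hκ₂mem
    have h' : f κ₁ κ₂star ≤ f κ₁ (u κ₁) := hκ₂min (hu κ₁)
    have hsq : ‖κ₂star - u κ₁‖ ^ 2 ≤ 0 :=
      nonpos_of_mul_nonpos_right (by linarith) (half_pos hμ)
    have h0 : ‖κ₂star - u κ₁‖ = 0 := by nlinarith [norm_nonneg (κ₂star - u κ₁)]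
    exact (sub_eq_zero.1 (norm_eq_zero.1 h0)).symm
  have hgrad : ∀ x, HasGradientAt (fun x => f x κ₂star - f x (u x))
      (gradient (fun y => f y κ₂star) x - gradient (fun y => f y (u x)) x) x := fun x => by
    rw [hasGradientAt_iff_hasFDerivAt, map_sub]
    exact (hdiff _ hκ₂mem x).hasGradientAt.hasFDerivAt.sub
      (hasGradientAt_minimalValue hμ hsc' hdiff hlip1 hlip2 hu hmin x).hasFDerivAt
  simp only [hsInf]
  refine ⟨fun x => hmin x hκ₂mem, ⟨fun x => (hgrad x).differentiableAt, ?_⟩, ?_, ?_⟩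
  · refine LipschitzWith.of_dist_le_mul fun x y => ?_
    rw [dist_eq_norm, dist_eq_norm, (hgrad x).gradient, (hgrad y).gradient,
      Real.coe_toNNReal _ (by positivity), sub_sub_sub_comm]
    have h1 := (hlip1 _ hκ₂mem).norm_sub_le x y
    have h2 := norm_gradient_minimizer_sub_le hμ hsc' hdiff hlip1 hlip2 hu hmin y x
    rw [Real.coe_toNNReal _ hL'.le] at h1 h2
    rw [Real.coe_toNNReal _ hL.le] at h2
    calc _ ≤ _ := norm_sub_le _ _
      _ ≤ L' * ‖x - y‖ + (L' + L ^ 2 / μ) * ‖x - y‖ := add_le_add h1 h2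
      _ = _ := by ring
  · rw [huκ, sub_self]
  · rw [(hgrad κ₁).gradient, huκ, sub_self]
end
end
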